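/- Let 𝒳 and 𝒴 be countable sets, let 𝒮 = {μ_1, …, μ_m} be a finite set of pmfs on 𝒳, and let Q be a Markov kernel from 𝒳 to 𝒴 such that I(μ_α, Q) < ∞ for every α ∈ {1,…,m}. Set Ī = max_{α} I(μ_α, Q). Then there exist a probability space carrying a random variable Z valued in some measurable space 𝒵 and a measurable function g : 𝒳 × 𝒵 → 𝒴 such that, for every α ∈ {1,…,m}, if X_α ∼ μ_α is independent of Z and Y_α := g(X_α, Z), then the pair (X_α, Y_α) has joint pmf μ_α(x)Q(y|x), and H(Y_α | Z) ≤ Ī + log₂( m · (Ī + 1) ) + 4. -/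

import Mathlib

open MeasureTheory ProbabilityTheory

/-- Base-2 entropy of a pmf on a countable type: `H(p) = -∑ p(a) log₂ p(a)`. -/
noncomputable def ent2 {𝒴 : Type*} (p : PMF 𝒴) : ℝ :=
  ∑' y, -((p y).toReal * Real.logb 2 (p y).toReal)

/-- Joint pmf `μ(x) Q(y|x)` on `𝒳 × 𝒴` induced by a source pmf `μ` and a Markov kernel `Q`. -/
noncomputable def jointPMF {𝒳 𝒴 : Type*} (μ : PMF 𝒳) (Q : 𝒳 → PMF 𝒴) : PMF (𝒳 × 𝒴) :=
  μ.bind fun x => (Q x).map (Prod.mk x)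

/-- Summand of the mutual information `I(μ, Q)`:
`μ(x)Q(y|x) log₂ (Q(y|x) / q(y))` where `q = μ.bind Q` is the output marginal. -/
noncomputable def miSummand {𝒳 𝒴 : Type*} (μ : PMF 𝒳) (Q : 𝒳 → PMF 𝒴) (p : 𝒳 × 𝒴) : ℝ :=
  ((μ p.1) * (Q p.1 p.2)).toReal *
    Real.logb 2 ((Q p.1 p.2).toReal / ((μ.bind Q) p.2).toReal)

/-- Mutual information (base 2) `I(μ, Q) = ∑_{x,y} μ(x)Q(y|x) log₂ (Q(y|x)/q(y))`. -/
noncomputable def mutInfo {𝒳 𝒴 : Type*} (μ : PMF 𝒳) (Q : 𝒳 → PMF 𝒴) : ℝ :=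
  ∑' p, miSummand μ Q p

/-- `κ` is a regular conditional distribution of the (discrete-valued) random variable `Y`
given `Z`, under the probability measure `P`. -/
def IsCondDistrib {Ω 𝒴 𝒵 : Type*} [MeasurableSpace Ω] [MeasurableSpace 𝒵]
    (P : Measure Ω) (Y : Ω → 𝒴) (Z : Ω → 𝒵) (κ : 𝒵 → PMF 𝒴) : Prop :=
  (∀ y, Measurable fun z => κ z y) ∧
    ∀ (y : 𝒴) (A : Set 𝒵), MeasurableSet A →
      P {ω | Y ω = y ∧ Z ω ∈ A} = ∫⁻ z in A, κ z y ∂(P.map Z)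

/-- The standard exponential law on `ℝ`. -/
noncomputable def expLaw : Measure ℝ :=
  (volume.restrict (Set.Ioi 0)).withDensity fun t => ENNReal.ofReal (Real.exp (-t))

lemma lintegral_expLaw {φ : ℝ → ENNReal} (hφ : Measurable φ) :
    ∫⁻ t, φ t ∂expLaw = ∫⁻ t in Set.Ioi 0, ENNReal.ofReal (Real.exp (-t)) * φ t := by
  rw [expLaw, lintegral_withDensity_eq_lintegral_mul _ (by fun_prop) hφ]
  rfl

lemma expLaw_Ioi {a : ℝ} (ha : 0 ≤ a) :
    expLaw (Set.Ioi a) = ENNReal.ofReal (Real.exp (-a)) := by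
  rw [expLaw, withDensity_apply _ measurableSet_Ioi, Measure.restrict_restrict measurableSet_Ioi,
    Set.inter_eq_left.2 (Set.Ioi_subset_Ioi ha), ← ofReal_integral_eq_lintegral_ofReal,
    integral_exp_neg_Ioi]
  · simpa [IntegrableOn] using exp_neg_integrableOn_Ioi a one_pos
  · exact ae_of_all _ fun t => (Real.exp_pos _).le

lemma expLaw_compl_Ioi_zero : expLaw (Set.Ioi 0)ᶜ = 0 := by
  rw [expLaw, withDensity_apply _ measurableSet_Ioi.compl,
    Measure.restrict_restrict measurableSet_Ioi.compl,
    Set.compl_inter_self, Measure.restrict_empty, lintegral_zero_measure]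

instance : IsProbabilityMeasure expLaw := ⟨by
  rw [← measure_add_measure_compl measurableSet_Ioi, expLaw_compl_Ioi_zero, expLaw_Ioi le_rfl]
  simp⟩

/-- Product of standard exponential laws: the clocks of an exponential race indexed by `𝒴`. -/
noncomputable def clockLaw (𝒴 : Type*) : Measure (𝒴 → ℝ) := Measure.infinitePi fun _ => expLaw

instance (𝒴 : Type*) : IsProbabilityMeasure (clockLaw 𝒴) := by
  unfold clockLaw; infer_instance

lemma lintegral_clockLaw_eval {𝒴 : Type*} (y : 𝒴) {φ : ℝ → ENNReal} (hφ : Measurable φ) :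
    ∫⁻ z, φ (z y) ∂clockLaw 𝒴 = ∫⁻ t, φ t ∂expLaw := by
  rw [← Measure.infinitePi_map_eval (fun _ : 𝒴 => expLaw) y, lintegral_map hφ (by fun_prop)]
  rfl

lemma ae_clockLaw_pos {𝒴 : Type*} (y : 𝒴) : ∀ᵐ z ∂clockLaw 𝒴, 0 < z y := by
  have h : ∀ᵐ t ∂(clockLaw 𝒴).map (fun z => z y), 0 < t := by
    rw [clockLaw, Measure.infinitePi_map_eval]
    exact expLaw_compl_Ioi_zero
  exact ae_of_ae_map (measurable_pi_apply y).aemeasurable h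

open Classical in
lemma measurable_update_prod {𝒴 : Type*} (y : 𝒴) :
    Measurable fun p : ℝ × (𝒴 → ℝ) => Function.update p.2 y p.1 := by
  refine measurable_pi_lambda _ fun y' => ?_
  by_cases h : y' = y
  · subst h; simpa using measurable_fst
  · simp only [Function.update_of_ne h]; fun_prop

open Classical in
/-- Resampling one clock preserves the law of all the clocks. -/
lemma map_update_clockLaw {𝒴 : Type*} (y : 𝒴) :
    (expLaw.prod (clockLaw 𝒴)).map (fun p => Function.update p.2 y p.1) = clockLaw 𝒴 := by
  have hm := measurable_update_prod y
  refine Measure.eq_infinitePi _ fun s t ht => ?_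
  rw [Measure.map_apply hm (.pi s.countable_toSet fun _ _ => ht _)]
  have hpre : (fun p : ℝ × (𝒴 → ℝ) => Function.update p.2 y p.1) ⁻¹' (Set.pi s t)
      = (if y ∈ s then t y else Set.univ) ×ˢ Set.pi (s.erase y : Finset 𝒴) t := by
    ext ⟨a, w⟩
    simp only [Set.mem_preimage, Set.mem_pi, Set.mem_prod, Finset.mem_coe, Finset.mem_erase]
    constructor
    · intro h
      refine ⟨?_, fun i hi => by simpa [Function.update_of_ne hi.1] using h i hi.2⟩
      split_ifs with hy
      · simpa using h y hy
      · trivial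
    · rintro ⟨h₁, h₂⟩ i hi
      by_cases hiy : i = y
      · subst hiy; simpa [hi] using h₁
      · simpa [Function.update_of_ne hiy] using h₂ i ⟨hiy, hi⟩
  rw [hpre, Measure.prod_prod, clockLaw, Measure.infinitePi_pi _ fun i _ => ht i]
  split_ifs with hy
  · exact Finset.mul_prod_erase s (fun i => expLaw (t i)) hy
  · rw [Finset.erase_eq_of_notMem hy, measure_univ, one_mul]

/-- The event that `y` strictly wins the race in which `y'` runs for time `z y' / p y'`. -/
def winSet {𝒴 : Type*} (p : PMF 𝒴) (y : 𝒴) : Set (𝒴 → ℝ) :=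
  {z | ∀ y', y' ≠ y → z y * (p y').toReal < z y' * (p y).toReal}

lemma measurableSet_winSet {𝒴 : Type*} [Countable 𝒴] (p : PMF 𝒴) (y : 𝒴) :
    MeasurableSet (winSet p y) := by
  have : winSet p y = ⋂ y', ⋂ (_ : y' ≠ y),
      {z : 𝒴 → ℝ | z y * (p y').toReal < z y' * (p y).toReal} := by
    ext z; simp [winSet]
  rw [this]
  exact .iInter fun y' => .iInter fun _ => measurableSet_lt (by fun_prop) (by fun_prop)

lemma winSet_unique {𝒴 : Type*} {p : PMF 𝒴} {y y' : 𝒴} {z : 𝒴 → ℝ}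
    (h : z ∈ winSet p y) (h' : z ∈ winSet p y') : y = y' := by
  by_contra hne
  exact lt_asymm (h y' (Ne.symm hne)) (h' y hne)

lemma hasSum_toReal_pmf {𝒴 : Type*} (p : PMF 𝒴) : HasSum (fun y => (p y).toReal) 1 := by
  have h := ENNReal.hasSum_toReal p.tsum_coe_ne_top
  rwa [← ENNReal.tsum_toReal_eq p.apply_ne_top, p.tsum_coe, ENNReal.toReal_one] at h

open Classical in
/-- The probability that all the other clocks ring after the winning time of `y`. -/
lemma clockLaw_others {𝒴 : Type*} [Countable 𝒴] (p : PMF 𝒴) {y : 𝒴} (hy : p y ≠ 0) {t : ℝ}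
    (ht : 0 < t) :
    clockLaw 𝒴 {w | ∀ y', y' ≠ y → t * (p y').toReal < w y' * (p y).toReal}
      = ENNReal.ofReal (Real.exp (-(t * (1 - (p y).toReal) / (p y).toReal))) := by
  have hp : 0 < (p y).toReal := ENNReal.toReal_pos hy (p.apply_ne_top y)
  let T : 𝒴 → Set ℝ := fun y' => if y' = y then Set.univ else
    Set.Ioi (t * (p y').toReal / (p y).toReal)
  let a : 𝒴 → ℝ := fun y' => t * (Function.update (fun y => (p y).toReal) y 0 y') / (p y).toReal
  have hset : {w : 𝒴 → ℝ | ∀ y', y' ≠ y → t * (p y').toReal < w y' * (p y).toReal}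
      = Set.univ.pi T := by
    ext w
    simp only [Set.mem_ofPred_eq, Set.mem_pi, Set.mem_univ, true_implies, T]
    refine forall_congr' fun y' => ?_
    by_cases h : y' = y
    · simp [h]
    · simp [h, div_lt_iff₀ hp]
  have hT : ∀ y', expLaw (T y') = ENNReal.ofReal (Real.exp (-a y')) := by
    intro y'
    by_cases h : y' = y
    · simp [T, a, h]
    · simp only [T, a, h, if_false, Function.update_of_ne h]
      exact expLaw_Ioi (by positivity)
  have hsum : HasSum a (t * (1 - (p y).toReal) / (p y).toReal) := by
    have := (((hasSum_toReal_pmf p).update y 0).mul_left t).div_const (p y).toReal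
    rwa [show t * (0 - (p y).toReal + 1) / (p y).toReal
      = t * (1 - (p y).toReal) / (p y).toReal by ring] at this
  rw [hset, clockLaw, Measure.infinitePi_pi_univ]
  · simp_rw [hT]
    refine HasProd.tprod_eq ?_
    have h := (ENNReal.continuous_ofReal.tendsto _).comp hsum.neg.rexp
    refine h.congr fun s => ?_
    simp [ENNReal.ofReal_prod_of_nonneg, Real.exp_nonneg]
  · intro y'
    by_cases h : y' = y <;> simp [T, h]

open Classical in
/-- On the event that `y` wins, its clock has sub-density `exp (-t / p y)`. -/
lemma lintegral_winSet {𝒴 : Type*} [Countable 𝒴] (p : PMF 𝒴) {y : 𝒴} (hy : p y ≠ 0)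
    {φ : ℝ → ENNReal} (hφ : Measurable φ) :
    ∫⁻ z in winSet p y, φ (z y) ∂clockLaw 𝒴
      = ∫⁻ t in Set.Ioi 0, ENNReal.ofReal (Real.exp (-(t / (p y).toReal))) * φ t := by
  have hp : 0 < (p y).toReal := ENNReal.toReal_pos hy (p.apply_ne_top y)
  have hm := measurable_update_prod y
  have hmeas : Measurable ((winSet p y).indicator fun z => φ (z y)) :=
    (hφ.comp (measurable_pi_apply y)).indicator (measurableSet_winSet p y)
  rw [← lintegral_indicator (measurableSet_winSet p y), ← map_update_clockLaw y,
    lintegral_map hmeas hm,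
    lintegral_prod (fun q : ℝ × (𝒴 → ℝ) => (winSet p y).indicator (fun z => φ (z y))
      (Function.update q.2 y q.1)) (hmeas.comp hm).aemeasurable]
  have key : ∀ t w, (winSet p y).indicator (fun z => φ (z y)) (Function.update w y t)
      = {w : 𝒴 → ℝ | ∀ y', y' ≠ y → t * (p y').toReal < w y' * (p y).toReal}.indicator
          (fun _ => φ t) w := by
    intro t w
    refine if_congr ?_ (by simp) rfl
    simp only [winSet, Set.mem_ofPred_eq, Function.update_self]
    refine forall₂_congr fun y' h => ?_
    rw [Function.update_of_ne h]
  have hW : ∀ t, MeasurableSet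
      {w : 𝒴 → ℝ | ∀ y', y' ≠ y → t * (p y').toReal < w y' * (p y).toReal} := fun t => by
    simp only [Set.ofPred_forall]
    exact .iInter fun y' => .iInter fun _ => measurableSet_lt (by fun_prop) (by fun_prop)
  simp_rw [key, lintegral_indicator_const (hW _)]
  have hφm : Measurable fun t : ℝ =>
      ENNReal.ofReal (Real.exp (-(t * (1 - (p y).toReal) / (p y).toReal))) := by fun_prop
  have hae : ∀ᵐ t ∂expLaw, 0 < t := expLaw_compl_Ioi_zero
  rw [lintegral_congr_ae (hae.mono fun t ht => by rw [clockLaw_others p hy ht]),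
    lintegral_expLaw (φ := fun t => φ t * ENNReal.ofReal
      (Real.exp (-(t * (1 - (p y).toReal) / (p y).toReal)))) (hφ.mul hφm)]
  refine lintegral_congr fun t => ?_
  rw [mul_left_comm, ← ENNReal.ofReal_mul (Real.exp_nonneg _), ← Real.exp_add, mul_comm (φ t)]
  congr 4
  field_simp
  ring

lemma integrableOn_exp_neg_div {r : ℝ} (hr : 0 < r) :
    IntegrableOn (fun t => Real.exp (-(t / r))) (Set.Ioi 0) := by
  refine (exp_neg_integrableOn_Ioi 0 (inv_pos.2 hr)).congr_fun (fun t _ => ?_) measurableSet_Ioi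
  simp only [div_eq_mul_inv]
  ring_nf

lemma integral_exp_neg_div {r : ℝ} (hr : 0 < r) :
    ∫ t in Set.Ioi 0, Real.exp (-(t / r)) = r := by
  have h := integral_exp_mul_Ioi (neg_neg_of_pos (inv_pos.2 hr)) 0
  simpa [div_eq_mul_inv, mul_comm] using h

lemma integral_mul_exp_neg_div {r : ℝ} (hr : 0 < r) :
    ∫ t in Set.Ioi 0, t * Real.exp (-(t / r)) = r ^ 2 := by
  have h := Real.integral_rpow_mul_exp_neg_mul_Ioi two_pos (inv_pos.2 hr)
  have h2 : Real.Gamma 2 = 1 := by simp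
  norm_num [h2] at h
  simpa [div_eq_mul_inv, mul_comm] using h

lemma integrableOn_mul_exp_neg_div {r : ℝ} (hr : 0 < r) :
    IntegrableOn (fun t => t * Real.exp (-(t / r))) (Set.Ioi 0) := by
  by_contra h
  have h0 := integral_mul_exp_neg_div hr
  rw [integral_undef h] at h0
  exact (pow_pos hr 2).ne h0

lemma lintegral_exp_neg_div {r : ℝ} (hr : 0 < r) :
    ∫⁻ t in Set.Ioi 0, ENNReal.ofReal (Real.exp (-(t / r))) = ENNReal.ofReal r := by
  rw [← ofReal_integral_eq_lintegral_ofReal (integrableOn_exp_neg_div hr)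
    (ae_of_all _ fun t => (Real.exp_pos _).le), integral_exp_neg_div hr]

lemma clockLaw_winSet {𝒴 : Type*} [Countable 𝒴] (p : PMF 𝒴) {y : 𝒴} (hy : p y ≠ 0) :
    clockLaw 𝒴 (winSet p y) = p y := by
  have h := lintegral_winSet p hy (φ := fun _ => 1) measurable_const
  simp only [mul_one, lintegral_const, Measure.restrict_apply_univ, one_mul] at h
  rw [h, lintegral_exp_neg_div (ENNReal.toReal_pos hy (p.apply_ne_top y)),
    ENNReal.ofReal_toReal (p.apply_ne_top y)]

/-- A tangent line bound for the expected logarithm under the density `exp (-t / r)`. -/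
lemma lintegral_exp_neg_div_mul_log_le {r q : ℝ} (hr : 0 < r) (hq : 0 < q) :
    ∫⁻ t in Set.Ioi 0, ENNReal.ofReal (Real.exp (-(t / r))) * ENNReal.ofReal (Real.log (1 + t / q))
      ≤ ENNReal.ofReal (r * Real.log (1 + r / q)) := by
  let c₀ := Real.log (1 + r / q) - r / (q + r)
  let B : ℝ → ℝ := fun t => c₀ * Real.exp (-(t / r)) + (q + r)⁻¹ * (t * Real.exp (-(t / r)))
  have hB : IntegrableOn B (Set.Ioi 0) :=
    ((integrableOn_exp_neg_div hr).const_mul _).add ((integrableOn_mul_exp_neg_div hr).const_mul _)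
  have hle : ∀ t ∈ Set.Ioi (0 : ℝ), Real.exp (-(t / r)) * Real.log (1 + t / q) ≤ B t := by
    intro t ht
    have ht : 0 < t := ht
    have h1 : 0 < 1 + t / q := by positivity
    have h2 : 0 < 1 + r / q := by positivity
    have h3 := Real.log_le_sub_one_of_pos (div_pos h1 h2)
    rw [Real.log_div h1.ne' h2.ne'] at h3
    have h4 : (1 + t / q) / (1 + r / q) - 1 = t / (q + r) - r / (q + r) := by
      field_simp; ring
    have h5 : Real.log (1 + t / q) ≤ c₀ + t / (q + r) := by simp only [c₀]; linarith
    calc _ ≤ Real.exp (-(t / r)) * (c₀ + t / (q + r)) := by gcongr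
      _ = B t := by simp only [B]; ring
  have hnn : ∀ t ∈ Set.Ioi (0 : ℝ), 0 ≤ B t := fun t ht => by
    have ht : 0 < t := ht
    refine le_trans (mul_nonneg (Real.exp_pos _).le (Real.log_nonneg ?_)) (hle t ht)
    have : 0 < t / q := by positivity
    linarith
  have hint : ∫ t in Set.Ioi 0, B t = r * Real.log (1 + r / q) := by
    rw [integral_add ((integrableOn_exp_neg_div hr).const_mul _)
      ((integrableOn_mul_exp_neg_div hr).const_mul _), integral_const_mul, integral_const_mul,
      integral_exp_neg_div hr, integral_mul_exp_neg_div hr]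
    simp only [c₀]
    field_simp
    ring
  rw [← hint, ofReal_integral_eq_lintegral_ofReal hB
    ((ae_restrict_iff' measurableSet_Ioi).2 (ae_of_all _ hnn))]
  refine setLIntegral_mono' measurableSet_Ioi fun t ht => ?_
  rw [← ENNReal.ofReal_mul (Real.exp_pos _).le]
  exact ENNReal.ofReal_le_ofReal (hle t ht)

open Classical in
/-- The winner of the race; an arbitrary point of the support if there is none. -/
noncomputable def winner {𝒴 : Type*} (p : PMF 𝒴) (z : 𝒴 → ℝ) : 𝒴 :=
  if h : ∃ y, p y ≠ 0 ∧ z ∈ winSet p y then h.choose else p.support_nonempty.some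

lemma winner_eq_of_mem {𝒴 : Type*} {p : PMF 𝒴} {y : 𝒴} {z : 𝒴 → ℝ} (hy : p y ≠ 0)
    (hz : z ∈ winSet p y) : winner p z = y := by
  have h : ∃ y, p y ≠ 0 ∧ z ∈ winSet p y := ⟨y, hy, hz⟩
  rw [winner, dif_pos h]
  exact winSet_unique h.choose_spec.2 hz

lemma apply_winner_ne_zero {𝒴 : Type*} (p : PMF 𝒴) (z : 𝒴 → ℝ) : p (winner p z) ≠ 0 := by
  unfold winner
  split_ifs with h
  · exact h.choose_spec.1
  · exact (p.mem_support_iff _).1 p.support_nonempty.some_mem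

lemma setOf_winner_eq_of_apply_eq_zero {𝒴 : Type*} {p : PMF 𝒴} {y : 𝒴} (hy : p y = 0) :
    {z | winner p z = y} = ∅ :=
  Set.eq_empty_of_forall_notMem fun z (hz : winner p z = y) =>
    apply_winner_ne_zero p z (by rwa [hz])

lemma measurable_winner {𝒴 : Type*} [Countable 𝒴] [MeasurableSpace 𝒴]
    [DiscreteMeasurableSpace 𝒴] (p : PMF 𝒴) : Measurable (winner p) := by
  refine measurable_to_countable' fun y => ?_
  by_cases hy : p y = 0
  · change MeasurableSet {z | winner p z = y}
    simp [setOf_winner_eq_of_apply_eq_zero hy]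
  let N : Set (𝒴 → ℝ) := (⋃ y, ⋃ (_ : p y ≠ 0), winSet p y)ᶜ
  have hN : MeasurableSet N :=
    (MeasurableSet.iUnion fun y => .iUnion fun _ => measurableSet_winSet p y).compl
  have hpre : winner p ⁻¹' {y} =
      winSet p y ∪ (N ∩ {_z | p.support_nonempty.some = y}) := by
    ext z
    simp only [Set.mem_preimage, Set.mem_singleton_iff, Set.mem_union, Set.mem_inter_iff,
      Set.mem_ofPred_eq, N, Set.mem_compl_iff, Set.mem_iUnion, exists_prop]
    by_cases h : ∃ y, p y ≠ 0 ∧ z ∈ winSet p y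
    · obtain ⟨y', hy', hz⟩ := id h
      rw [winner_eq_of_mem hy' hz]
      refine ⟨fun e => .inl (e ▸ hz), ?_⟩
      rintro (hz' | hz')
      · exact winSet_unique hz hz'
      · exact absurd h hz'.1
    · rw [winner, dif_neg h]
      exact ⟨fun e => .inr ⟨h, e⟩, fun e => e.elim (fun hz => absurd ⟨y, hy, hz⟩ h) (·.2)⟩
  rw [hpre]
  exact (measurableSet_winSet p y).union (hN.inter (.const _))

lemma clockLaw_winner_eq {𝒴 : Type*} [Countable 𝒴] (p : PMF 𝒴) (y : 𝒴) :
    clockLaw 𝒴 {z | winner p z = y} = p y := by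
  let _ : MeasurableSpace 𝒴 := ⊤
  have hge : ∀ y, p y ≤ clockLaw 𝒴 {z | winner p z = y} := fun y => by
    by_cases hy : p y = 0
    · simp [hy]
    · rw [← clockLaw_winSet p hy]
      exact measure_mono fun z hz => winner_eq_of_mem hy hz
  have hsum : ∑' y, clockLaw 𝒴 {z | winner p z = y} = 1 := by
    have h := measure_iUnion (μ := clockLaw 𝒴) (f := fun y => {z | winner p z = y})
      (fun y y' hne => Set.disjoint_left.2 fun z hz hz' => hne (hz.symm.trans hz'))
      (fun y => measurable_winner p (measurableSet_singleton y))
    rw [← h, ← measure_univ (μ := clockLaw 𝒴)]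
    congr 1
    ext z; simp
  refine le_antisymm ?_ (hge y)
  by_contra! hlt
  have := ENNReal.tsum_lt_tsum (p.tsum_coe_ne_top) hge hlt
  rw [hsum, p.tsum_coe] at this
  exact lt_irrefl _ this

lemma winSet_ae_eq_winner {𝒴 : Type*} [Countable 𝒴] (p : PMF 𝒴) {y : 𝒴} (hy : p y ≠ 0) :
    winSet p y =ᵐ[clockLaw 𝒴] {z | winner p z = y} :=
  ae_eq_of_subset_of_measure_ge (fun _ hz => winner_eq_of_mem hy hz)
    (by rw [clockLaw_winner_eq, clockLaw_winSet p hy])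
    (measurableSet_winSet p y).nullMeasurableSet (measure_ne_top _ _)

lemma lintegral_winner_log_le {𝒴 : Type*} [Countable 𝒴] (p : PMF 𝒴) (y : 𝒴) {q : ℝ}
    (hq : 0 < q) :
    ∫⁻ z in {z | winner p z = y}, ENNReal.ofReal (Real.log (1 + z y / q)) ∂clockLaw 𝒴
      ≤ ENNReal.ofReal ((p y).toReal * Real.log (1 + (p y).toReal / q)) := by
  by_cases hy : p y = 0
  · simp [setOf_winner_eq_of_apply_eq_zero hy]
  rw [← setLIntegral_congr (winSet_ae_eq_winner p hy),
    lintegral_winSet p hy (φ := fun t => ENNReal.ofReal (Real.log (1 + t / q))) (by fun_prop)]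
  exact lintegral_exp_neg_div_mul_log_le (ENNReal.toReal_pos hy (p.apply_ne_top y)) hq

lemma lintegral_Ioi_rpow_le {q s : ℝ} (hq : 0 < q) (hs : 0 < s) :
    ∫⁻ t in Set.Ioi 0, ENNReal.ofReal ((1 + t / q) ^ (-(1 + s))) ≤ ENNReal.ofReal (q / s) := by
  have hd : ∀ t ∈ Set.Ici (0 : ℝ), HasDerivAt (fun t => -(q / s) * (1 + t / q) ^ (-s))
      ((1 + t / q) ^ (-(1 + s))) t := by
    intro t ht
    have ht : 0 ≤ t := ht
    have h1 : 0 < 1 + t / q := by positivity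
    refine (((((hasDerivAt_id t).div_const q).const_add 1).rpow_const (p := -s)
      (.inl h1.ne')).const_mul (-(q / s))).congr_deriv ?_
    rw [show -(1 + s) = -s - 1 by ring]
    simp only [id]
    field_simp
  have hpos : ∀ t ∈ Set.Ioi (0 : ℝ), 0 ≤ (1 + t / q) ^ (-(1 + s)) := fun t ht => by
    have ht : 0 < t := ht
    positivity
  have hlim : Filter.Tendsto (fun t => -(q / s) * (1 + t / q) ^ (-s)) Filter.atTop (nhds 0) := by
    have h := (tendsto_rpow_neg_atTop hs).comp
      (Filter.tendsto_atTop_add_const_left _ 1 (Filter.tendsto_id.atTop_div_const hq))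
    simpa using h.const_mul (-(q / s))
  rw [← ofReal_integral_eq_lintegral_ofReal (integrableOn_Ioi_deriv_of_nonneg' hd hpos hlim)
    ((ae_restrict_iff' measurableSet_Ioi).2 (ae_of_all _ hpos)),
    integral_Ioi_of_hasDerivAt_of_nonneg' hd hpos hlim]
  simp

lemma lintegral_clockLaw_rpow_le {𝒴 : Type*} (y : 𝒴) {q s : ℝ} (hq : 0 < q) (hs : 0 < s) :
    ∫⁻ z, ENNReal.ofReal ((1 + z y / q) ^ (-(1 + s))) ∂clockLaw 𝒴 ≤ ENNReal.ofReal (q / s) := by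
  rw [lintegral_clockLaw_eval y (φ := fun t => ENNReal.ofReal ((1 + t / q) ^ (-(1 + s))))
    (by fun_prop), lintegral_expLaw (by fun_prop)]
  refine (setLIntegral_mono' measurableSet_Ioi fun t ht => ?_).trans (lintegral_Ioi_rpow_le hq hs)
  refine mul_le_of_le_one_left zero_le ?_
  rw [ENNReal.ofReal_le_one, Real.exp_le_one_iff]
  exact neg_nonpos.2 (le_of_lt ht)

/-- Entropy integrand bound against the unnormalised weight `u ^ (-(1 + s))`. -/
lemma negMulLog_add_le {k u s : ℝ} (hk : 0 ≤ k) (hu : 1 ≤ u) (hs : 0 < s) :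
    Real.negMulLog k + k ≤
      (1 + s) * (k * Real.log u) + Real.log s⁻¹ * k + s * u ^ (-(1 + s)) := by
  have hu0 : 0 < u := by linarith
  rcases hk.eq_or_lt with rfl | hk
  · simp only [Real.negMulLog_zero, zero_mul, mul_zero, add_zero, zero_add]
    positivity
  · have hf : 0 < u ^ (-(1 + s)) := Real.rpow_pos_of_pos hu0 _
    have h := Real.log_le_sub_one_of_pos (div_pos (mul_pos hs hf) hk)
    rw [Real.log_div (by positivity) hk.ne', Real.log_mul hs.ne' hf.ne', Real.log_rpow hu0] at h
    have h' := mul_le_mul_of_nonneg_left h hk.le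
    rw [mul_sub k (_ / k), mul_div_cancel₀ _ hk.ne'] at h'
    rw [Real.negMulLog, Real.log_inv]
    nlinarith

/-- The law of the winner for a random `x ∼ μ`, given the clocks `z`. -/
noncomputable def winnerLaw {𝒳 𝒴 : Type*} (μ : PMF 𝒳) (Q : 𝒳 → PMF 𝒴) (z : 𝒴 → ℝ) : PMF 𝒴 :=
  μ.map fun x => winner (Q x) z

lemma winnerLaw_apply {𝒳 𝒴 : Type*} (μ : PMF 𝒳) (Q : 𝒳 → PMF 𝒴) (z : 𝒴 → ℝ) (y : 𝒴) :
    winnerLaw μ Q z y = ∑' x, {z | winner (Q x) z = y}.indicator (fun _ => μ x) z := by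
  classical
  rw [winnerLaw, PMF.map_apply]
  refine tsum_congr fun x => ?_
  simp only [Set.indicator, Set.mem_ofPred_eq, eq_comm]

lemma measurableSet_winner_eq {𝒴 : Type*} [Countable 𝒴] (p : PMF 𝒴) (y : 𝒴) :
    MeasurableSet {z | winner p z = y} := by
  let _ : MeasurableSpace 𝒴 := ⊤
  exact measurable_winner p (measurableSet_singleton y)

lemma measurable_winnerLaw {𝒳 𝒴 : Type*} [Countable 𝒳] [Countable 𝒴] (μ : PMF 𝒳) (Q : 𝒳 → PMF 𝒴)
    (y : 𝒴) : Measurable fun z => winnerLaw μ Q z y := by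
  simp_rw [winnerLaw_apply]
  exact .tsum fun x => measurable_const.indicator (measurableSet_winner_eq _ _)

lemma lintegral_winnerLaw_mul {𝒳 𝒴 : Type*} [Countable 𝒳] [Countable 𝒴] (μ : PMF 𝒳)
    (Q : 𝒳 → PMF 𝒴) (y : 𝒴) {φ : (𝒴 → ℝ) → ENNReal} (hφ : Measurable φ) :
    ∫⁻ z, winnerLaw μ Q z y * φ z ∂clockLaw 𝒴
      = ∑' x, μ x * ∫⁻ z in {z | winner (Q x) z = y}, φ z ∂clockLaw 𝒴 := by
  simp_rw [winnerLaw_apply, ← ENNReal.tsum_mul_right]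
  have hm : ∀ x, AEMeasurable
      (fun z => {z | winner (Q x) z = y}.indicator (fun _ => μ x) z * φ z) (clockLaw 𝒴) := fun x =>
    ((measurable_const.indicator (measurableSet_winner_eq _ _)).mul hφ).aemeasurable
  rw [lintegral_tsum hm]
  refine tsum_congr fun x => ?_
  rw [← lintegral_const_mul _ hφ, ← lintegral_indicator (measurableSet_winner_eq _ _)]
  refine lintegral_congr fun z => ?_
  by_cases h : z ∈ {z | winner (Q x) z = y} <;> simp [h]

lemma lintegral_winnerLaw {𝒳 𝒴 : Type*} [Countable 𝒳] [Countable 𝒴] (μ : PMF 𝒳)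
    (Q : 𝒳 → PMF 𝒴) (y : 𝒴) : ∫⁻ z, winnerLaw μ Q z y ∂clockLaw 𝒴 = μ.bind Q y := by
  have h := lintegral_winnerLaw_mul μ Q y (φ := fun _ => 1) measurable_const
  simpa [clockLaw_winner_eq] using h

lemma lintegral_negMulLog_winnerLaw_add_le {𝒳 𝒴 : Type*} [Countable 𝒳] [Countable 𝒴] (μ : PMF 𝒳)
    (Q : 𝒳 → PMF 𝒴) (y : 𝒴) {s : ℝ} (hs : 0 < s) (hs1 : s ≤ 1) :
    ∫⁻ z, ENNReal.ofReal (Real.negMulLog (winnerLaw μ Q z y).toReal) ∂clockLaw 𝒴 + μ.bind Q y ≤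
      ENNReal.ofReal (1 + s) * ∑' x, μ x * ENNReal.ofReal
        ((Q x y).toReal * Real.log (1 + (Q x y).toReal / (μ.bind Q y).toReal))
      + ENNReal.ofReal (Real.log s⁻¹) * μ.bind Q y + μ.bind Q y := by
  set q := (μ.bind Q y).toReal with hqdef
  have hk := measurable_winnerLaw μ Q y
  have hlogs : 0 ≤ Real.log s⁻¹ := Real.log_nonneg ((one_le_inv₀ hs).2 hs1)
  by_cases hq0 : μ.bind Q y = 0
  · have h0 : ∫⁻ z, ENNReal.ofReal (Real.negMulLog (winnerLaw μ Q z y).toReal) ∂clockLaw 𝒴 = 0 := by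
      have h := lintegral_winnerLaw μ Q y
      rw [hq0, lintegral_eq_zero_iff hk] at h
      refine lintegral_eq_zero_of_ae_eq_zero (h.mono fun z hz => ?_)
      have hz : winnerLaw μ Q z y = 0 := hz
      simp [hz]
    rw [h0, hq0]
    simp
  have hq : 0 < q := ENNReal.toReal_pos hq0 ((μ.bind Q).apply_ne_top y)
  have hL : Measurable fun z : 𝒴 → ℝ => ENNReal.ofReal (Real.log (1 + z y / q)) := by fun_prop
  calc ∫⁻ z, ENNReal.ofReal (Real.negMulLog (winnerLaw μ Q z y).toReal) ∂clockLaw 𝒴 + μ.bind Q y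
      = ∫⁻ z, (ENNReal.ofReal (Real.negMulLog (winnerLaw μ Q z y).toReal) + winnerLaw μ Q z y)
          ∂clockLaw 𝒴 := by
        rw [lintegral_add_right _ hk, lintegral_winnerLaw]
    _ ≤ ∫⁻ z, (ENNReal.ofReal (1 + s) *
            (winnerLaw μ Q z y * ENNReal.ofReal (Real.log (1 + z y / q)))
          + ENNReal.ofReal (Real.log s⁻¹) * winnerLaw μ Q z y
          + ENNReal.ofReal s * ENNReal.ofReal ((1 + z y / q) ^ (-(1 + s)))) ∂clockLaw 𝒴 := by
        refine lintegral_mono_ae ((ae_clockLaw_pos y).mono fun z hz => ?_)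
        have hu : 1 ≤ 1 + z y / q := by
          have : 0 < z y / q := by positivity
          linarith
        have hlog := Real.log_nonneg hu
        have hK := ENNReal.ofReal_toReal ((winnerLaw μ Q z).apply_ne_top y)
        have hk0 : 0 ≤ (winnerLaw μ Q z y).toReal := ENNReal.toReal_nonneg
        have hk1 : (winnerLaw μ Q z y).toReal ≤ 1 :=
          ENNReal.toReal_le_of_le_ofReal zero_le_one (by simpa using (winnerLaw μ Q z).coe_le_one y)
        have h := ENNReal.ofReal_le_ofReal (negMulLog_add_le hk0 hu hs)
        rw [ENNReal.ofReal_add (Real.negMulLog_nonneg hk0 hk1) hk0,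
          ENNReal.ofReal_add (by positivity) (by positivity),
          ENNReal.ofReal_add (by positivity) (by positivity),
          ENNReal.ofReal_mul (by positivity), ENNReal.ofReal_mul hk0, ENNReal.ofReal_mul hlogs,
          ENNReal.ofReal_mul hs.le, hK] at h
        exact h
    _ = ENNReal.ofReal (1 + s) * ∑' x, μ x *
            ∫⁻ z in {z | winner (Q x) z = y}, ENNReal.ofReal (Real.log (1 + z y / q)) ∂clockLaw 𝒴
          + ENNReal.ofReal (Real.log s⁻¹) * μ.bind Q y
          + ENNReal.ofReal s * ∫⁻ z, ENNReal.ofReal ((1 + z y / q) ^ (-(1 + s))) ∂clockLaw 𝒴 := by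
        rw [lintegral_add_right _ (by fun_prop), lintegral_add_right _ (by fun_prop),
          lintegral_const_mul _ (by fun_prop), lintegral_const_mul _ hk,
          lintegral_const_mul _ (by fun_prop), lintegral_winnerLaw_mul μ Q y hL,
          lintegral_winnerLaw]
    _ ≤ _ := by
        gcongr with x
        · exact lintegral_winner_log_le (Q x) y hq
        · refine (mul_le_mul_right (lintegral_clockLaw_rpow_le y hq hs) _).trans_eq ?_
          rw [← ENNReal.ofReal_mul hs.le, mul_div_cancel₀ _ hs.ne', hqdef,
            ENNReal.ofReal_toReal ((μ.bind Q).apply_ne_top y)]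

lemma hasSum_toReal_mul {𝒳 𝒴 : Type*} (μ : PMF 𝒳) (R : 𝒳 → PMF 𝒴) :
    HasSum (fun p : 𝒳 × 𝒴 => (μ p.1 * R p.1 p.2).toReal) 1 := by
  have h1 : ∑' p : 𝒳 × 𝒴, μ p.1 * R p.1 p.2 = 1 := by
    rw [ENNReal.tsum_prod (f := fun x y => μ x * R x y)]
    simp [ENNReal.tsum_mul_left, PMF.tsum_coe]
  have h := ENNReal.hasSum_toReal (h1.trans_ne ENNReal.one_ne_top)
  have hne : ∀ p : 𝒳 × 𝒴, μ p.1 * R p.1 p.2 ≠ ⊤ := fun p =>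
    ENNReal.mul_ne_top (μ.apply_ne_top _) ((R p.1).apply_ne_top _)
  rwa [← ENNReal.tsum_toReal_eq hne, h1, ENNReal.toReal_one] at h

lemma apply_eq_zero_of_bind_eq_zero {𝒳 𝒴 : Type*} {μ : PMF 𝒳} {Q : 𝒳 → PMF 𝒴} {y : 𝒴}
    (h : μ.bind Q y = 0) (x : 𝒳) : μ x * Q x y = 0 := by
  rw [PMF.bind_apply, ENNReal.tsum_eq_zero] at h
  exact h x

lemma miSummand_mul_log_two {𝒳 𝒴 : Type*} (μ : PMF 𝒳) (Q : 𝒳 → PMF 𝒴) (p : 𝒳 × 𝒴) :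
    miSummand μ Q p * Real.log 2 = (μ p.1 * Q p.1 p.2).toReal *
      Real.log ((Q p.1 p.2).toReal / (μ.bind Q p.2).toReal) := by
  have : Real.log 2 ≠ 0 := (Real.log_pos one_lt_two).ne'
  rw [miSummand, Real.logb]
  field_simp

lemma toReal_pos_of_mul_ne_zero {𝒳 𝒴 : Type*} {μ : PMF 𝒳} {Q : 𝒳 → PMF 𝒴} {x : 𝒳} {y : 𝒴}
    (h : μ x * Q x y ≠ 0) :
    0 < (μ x).toReal ∧ 0 < (Q x y).toReal ∧ 0 < (μ.bind Q y).toReal :=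
  ⟨ENNReal.toReal_pos (left_ne_zero_of_mul h) (μ.apply_ne_top x),
    ENNReal.toReal_pos (right_ne_zero_of_mul h) ((Q x).apply_ne_top y),
    ENNReal.toReal_pos (fun h0 => h (apply_eq_zero_of_bind_eq_zero h0 x))
      ((μ.bind Q).apply_ne_top y)⟩

lemma mutInfo_nonneg {𝒳 𝒴 : Type*} {μ : PMF 𝒳} {Q : 𝒳 → PMF 𝒴}
    (hI : Summable (miSummand μ Q)) : 0 ≤ mutInfo μ Q := by
  have hlog2 : 0 < Real.log 2 := Real.log_pos one_lt_two
  have h := hasSum_le (fun p => ?_) ((hasSum_toReal_mul μ Q).sub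
    (hasSum_toReal_mul μ fun _ => μ.bind Q)) (hI.hasSum.mul_right (Real.log 2))
  · rw [sub_self] at h
    exact nonneg_of_mul_nonneg_left h hlog2
  · obtain ⟨x, y⟩ := p
    rw [miSummand_mul_log_two]
    by_cases h0 : μ x * Q x y = 0
    · simp only [h0, ENNReal.toReal_zero, zero_sub, zero_mul]
      exact neg_nonpos.2 ENNReal.toReal_nonneg
    obtain ⟨hμ, hQ, hq⟩ := toReal_pos_of_mul_ne_zero h0
    have h := Real.log_le_sub_one_of_pos (div_pos hq hQ)
    rw [← inv_div, Real.log_inv] at h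
    simp only [ENNReal.toReal_mul]
    have h' := mul_le_mul_of_nonneg_left h (mul_pos hμ hQ).le
    have e : (μ x).toReal * (Q x y).toReal *
        ((((Q x y).toReal / (μ.bind Q y).toReal))⁻¹ - 1)
        = (μ x).toReal * (μ.bind Q y).toReal - (μ x).toReal * (Q x y).toReal := by
      field_simp
    linarith

lemma tsum_log_one_add_le {𝒳 𝒴 : Type*} {μ : PMF 𝒳} {Q : 𝒳 → PMF 𝒴}
    (hI : Summable (miSummand μ Q)) :
    ∑' y, ∑' x, μ x * ENNReal.ofReal
        ((Q x y).toReal * Real.log (1 + (Q x y).toReal / (μ.bind Q y).toReal))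
      ≤ ENNReal.ofReal ((mutInfo μ Q + 1) * Real.log 2) := by
  let F : 𝒳 × 𝒴 → ℝ := fun p => (μ p.1).toReal *
    ((Q p.1 p.2).toReal * Real.log (1 + (Q p.1 p.2).toReal / (μ.bind Q p.2).toReal))
  have hF0 : ∀ p, 0 ≤ F p := fun p => by
    have : 0 ≤ (Q p.1 p.2).toReal / (μ.bind Q p.2).toReal := by positivity
    have := Real.log_nonneg (le_add_of_nonneg_right this)
    positivity
  have hG := ((hI.hasSum.mul_right (Real.log 2)).add
    ((hasSum_toReal_mul μ Q).mul_right (Real.log 2))).add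
    (((hasSum_toReal_mul μ fun _ => μ.bind Q).sub (hasSum_toReal_mul μ Q)).div_const 2)
  have hle : ∀ p, F p ≤ miSummand μ Q p * Real.log 2 + (μ p.1 * Q p.1 p.2).toReal * Real.log 2
      + ((μ p.1 * μ.bind Q p.2).toReal - (μ p.1 * Q p.1 p.2).toReal) / 2 := by
    rintro ⟨x, y⟩
    rw [miSummand_mul_log_two]
    simp only [F, ENNReal.toReal_mul]
    by_cases h0 : μ x * Q x y = 0
    · have h0' : (μ x).toReal * (Q x y).toReal = 0 := by rw [← ENNReal.toReal_mul, h0]; rfl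
      rw [← mul_assoc, h0']
      simp only [zero_mul, sub_zero, zero_add]
      positivity
    obtain ⟨hμ, hQ, hq⟩ := toReal_pos_of_mul_ne_zero h0
    have hρ : 0 < (Q x y).toReal / (μ.bind Q y).toReal := div_pos hQ hq
    set ρ := (Q x y).toReal / (μ.bind Q y).toReal with hρdef
    have h := Real.log_le_sub_one_of_pos (show 0 < (1 + ρ) / (ρ * 2) by positivity)
    rw [Real.log_div (by positivity) (by positivity), Real.log_mul hρ.ne' two_ne_zero] at h
    have h' := mul_le_mul_of_nonneg_left h (mul_pos hμ hQ).le
    have e : (μ x).toReal * (Q x y).toReal * ((1 + ρ) / (ρ * 2) - 1)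
        = ((μ x).toReal * (μ.bind Q y).toReal - (μ x).toReal * (Q x y).toReal) / 2 := by
      rw [hρdef]; field_simp; ring
    rw [e] at h'
    linarith
  have hFs : Summable F := hG.summable.of_nonneg_of_le hF0 hle
  calc _ = ∑' p : 𝒳 × 𝒴, ENNReal.ofReal (F p) := by
        rw [ENNReal.tsum_comm, ENNReal.tsum_prod']
        refine tsum_congr fun x => tsum_congr fun y => ?_
        simp only [F]
        rw [ENNReal.ofReal_mul (p := (μ x).toReal) ENNReal.toReal_nonneg,
          ENNReal.ofReal_toReal (μ.apply_ne_top x)]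
    _ = ENNReal.ofReal (∑' p, F p) := (ENNReal.ofReal_tsum_of_nonneg hF0 hFs).symm
    _ ≤ _ := by
        refine ENNReal.ofReal_le_ofReal ((hasSum_le hle hFs.hasSum hG).trans_eq ?_)
        rw [mutInfo]
        ring

lemma lintegral_tsum_negMulLog_winnerLaw_le {𝒳 𝒴 : Type*} [Countable 𝒳] [Countable 𝒴] {μ : PMF 𝒳}
    {Q : 𝒳 → PMF 𝒴} (hI : Summable (miSummand μ Q)) {s : ℝ} (hs : 0 < s) (hs1 : s ≤ 1) :
    ∫⁻ z, ∑' y, ENNReal.ofReal (Real.negMulLog (winnerLaw μ Q z y).toReal) ∂clockLaw 𝒴 ≤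
      ENNReal.ofReal ((1 + s) * ((mutInfo μ Q + 1) * Real.log 2) + Real.log s⁻¹) := by
  have hlogs : 0 ≤ Real.log s⁻¹ := Real.log_nonneg ((one_le_inv₀ hs).2 hs1)
  have hlog2 : 0 < Real.log 2 := Real.log_pos one_lt_two
  have hI0 := mutInfo_nonneg hI
  have hsum := ENNReal.tsum_le_tsum fun y => lintegral_negMulLog_winnerLaw_add_le μ Q y hs hs1
  rw [ENNReal.tsum_add, ENNReal.tsum_add, ENNReal.tsum_add, ENNReal.tsum_mul_left,
    ENNReal.tsum_mul_left, PMF.tsum_coe, mul_one] at hsum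
  have hmeas : ∀ y, AEMeasurable
      (fun z => ENNReal.ofReal (Real.negMulLog (winnerLaw μ Q z y).toReal)) (clockLaw 𝒴) :=
    fun y => (ENNReal.measurable_ofReal.comp (Real.continuous_negMulLog.measurable.comp
      (measurable_winnerLaw μ Q y).ennreal_toReal)).aemeasurable
  rw [lintegral_tsum hmeas]
  refine ((ENNReal.add_le_add_iff_right ENNReal.one_ne_top).1 hsum).trans ?_
  rw [ENNReal.ofReal_add (by positivity) hlogs, ENNReal.ofReal_mul (by positivity)]
  gcongr
  exact tsum_log_one_add_le hI

lemma ent2_mul_log_two {𝒴 : Type*} (p : PMF 𝒴) :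
    ent2 p * Real.log 2 = ∑' y, Real.negMulLog (p y).toReal := by
  have : Real.log 2 ≠ 0 := (Real.log_pos one_lt_two).ne'
  rw [ent2, ← tsum_mul_right]
  refine tsum_congr fun y => ?_
  rw [Real.logb, Real.negMulLog]
  field_simp

lemma ofReal_ent2_mul_log_two_le {𝒴 : Type*} (p : PMF 𝒴) :
    ENNReal.ofReal (ent2 p * Real.log 2) ≤ ∑' y, ENNReal.ofReal (Real.negMulLog (p y).toReal) := by
  have h0 : ∀ y, 0 ≤ Real.negMulLog (p y).toReal := fun y =>
    Real.negMulLog_nonneg ENNReal.toReal_nonneg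
      (ENNReal.toReal_le_of_le_ofReal zero_le_one (by simpa using p.coe_le_one y))
  rw [ent2_mul_log_two]
  by_cases h : Summable fun y => Real.negMulLog (p y).toReal
  · rw [ENNReal.ofReal_tsum_of_nonneg h0 h]
  · simp [tsum_eq_zero_of_not_summable h]

lemma ent2_nonneg {𝒴 : Type*} (p : PMF 𝒴) : 0 ≤ ent2 p := by
  refine nonneg_of_mul_nonneg_left ?_ (Real.log_pos one_lt_two)
  rw [ent2_mul_log_two]
  exact tsum_nonneg fun y => Real.negMulLog_nonneg ENNReal.toReal_nonneg
      (ENNReal.toReal_le_of_le_ofReal zero_le_one (by simpa using p.coe_le_one y))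

/-- The conditional entropy bound for a single source, in terms of an upper bound `J` on the
mutual information. -/
lemma integral_ent2_winnerLaw_le {𝒳 𝒴 : Type*} [Countable 𝒳] [Countable 𝒴] {μ : PMF 𝒳}
    {Q : 𝒳 → PMF 𝒴} (hI : Summable (miSummand μ Q)) {J : ℝ} (hJ : mutInfo μ Q ≤ J) :
    ∫ z, ent2 (winnerLaw μ Q z) ∂clockLaw 𝒴 ≤ J + Real.logb 2 (J + 1) + 2 := by
  have hI0 := mutInfo_nonneg hI
  have hJ1 : 1 ≤ J + 1 := by linarith
  have hlog2 : 0 < Real.log 2 := Real.log_pos one_lt_two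
  have hlogJ := Real.logb_nonneg one_lt_two hJ1
  by_cases hint : Integrable (fun z => ent2 (winnerLaw μ Q z)) (clockLaw 𝒴)
  swap
  · rw [integral_undef hint]
    linarith
  have hs : 0 < (J + 1)⁻¹ := by positivity
  have h1 := lintegral_tsum_negMulLog_winnerLaw_le hI hs (inv_le_one_of_one_le₀ hJ1)
  have h2 := (lintegral_mono fun z => ofReal_ent2_mul_log_two_le (winnerLaw μ Q z)).trans h1
  rw [← ofReal_integral_eq_lintegral_ofReal (hint.mul_const _)
    (ae_of_all _ fun z => mul_nonneg (ent2_nonneg _) hlog2.le), inv_inv,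
    ENNReal.ofReal_le_ofReal_iff (add_nonneg (by positivity) (Real.log_nonneg hJ1)),
    integral_mul_const] at h2
  have h3 : Real.log (J + 1) = Real.logb 2 (J + 1) * Real.log 2 := by
    rw [Real.logb]; field_simp
  rw [h3, ← mul_assoc, ← add_mul] at h2
  have h4 := le_of_mul_le_mul_right h2 hlog2
  have h5 : (1 + (J + 1)⁻¹) * (mutInfo μ Q + 1) ≤ (1 + (J + 1)⁻¹) * (J + 1) := by gcongr
  have h6 : (1 + (J + 1)⁻¹) * (J + 1) = J + 2 := by field_simp; ring
  linarith

lemma jointPMF_apply {𝒳 𝒴 : Type*} (μ : PMF 𝒳) (Q : 𝒳 → PMF 𝒴) (x : 𝒳) (y : 𝒴) :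
    jointPMF μ Q (x, y) = μ x * Q x y := by
  classical
  rw [jointPMF, PMF.bind_apply, tsum_eq_single x]
  · rw [PMF.map_apply, tsum_eq_single y]
    · simp
    · intro y' h
      simp [Ne.symm h]
  · intro x' h
    rw [PMF.map_apply, ENNReal.tsum_eq_zero.2, mul_zero]
    intro y'
    simp [Ne.symm h]

lemma measurable_winner_uncurry {𝒳 𝒴 : Type*} [Countable 𝒳] [Countable 𝒴]
    [MeasurableSpace 𝒳] [DiscreteMeasurableSpace 𝒳] [MeasurableSpace 𝒴]
    [DiscreteMeasurableSpace 𝒴] (Q : 𝒳 → PMF 𝒴) :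
    Measurable fun ω : 𝒳 × (𝒴 → ℝ) => winner (Q ω.1) ω.2 :=
  measurable_from_prod_countable_right fun x => measurable_winner (Q x)

lemma map_winner_eq_jointPMF {𝒳 𝒴 : Type*} [Countable 𝒳] [Countable 𝒴]
    [MeasurableSpace 𝒳] [DiscreteMeasurableSpace 𝒳] [MeasurableSpace 𝒴]
    [DiscreteMeasurableSpace 𝒴] (μ : PMF 𝒳) (Q : 𝒳 → PMF 𝒴) :
    ((μ.toMeasure.prod (clockLaw 𝒴)).map fun ω => (ω.1, winner (Q ω.1) ω.2))
      = (jointPMF μ Q).toMeasure := by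
  refine Measure.ext_of_singleton fun ⟨x, y⟩ => ?_
  rw [Measure.map_apply (measurable_fst.prodMk (measurable_winner_uncurry Q))
    (measurableSet_singleton _), PMF.toMeasure_apply_singleton _ _ (measurableSet_singleton _),
    jointPMF_apply]
  have hpre : (fun ω : 𝒳 × (𝒴 → ℝ) => (ω.1, winner (Q ω.1) ω.2)) ⁻¹' {(x, y)}
      = {x} ×ˢ {z | winner (Q x) z = y} := by
    ext ⟨x', z⟩
    simp only [Set.mem_preimage, Set.mem_singleton_iff, Prod.mk.injEq, Set.mem_prod,
      Set.mem_ofPred_eq]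
    exact and_congr_right fun h => by rw [h]
  rw [hpre, Measure.prod_prod, clockLaw_winner_eq,
    PMF.toMeasure_apply_singleton _ _ (measurableSet_singleton _)]

lemma isCondDistrib_winnerLaw {𝒳 𝒴 : Type*} [Countable 𝒳] [Countable 𝒴]
    [MeasurableSpace 𝒳] [DiscreteMeasurableSpace 𝒳] [MeasurableSpace 𝒴]
    [DiscreteMeasurableSpace 𝒴] (μ : PMF 𝒳) (Q : 𝒳 → PMF 𝒴) :
    IsCondDistrib (μ.toMeasure.prod (clockLaw 𝒴)) (fun ω => winner (Q ω.1) ω.2) Prod.snd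
      (winnerLaw μ Q) := by
  refine ⟨measurable_winnerLaw μ Q, fun y A hA => ?_⟩
  have hmeas : MeasurableSet {ω : 𝒳 × (𝒴 → ℝ) | winner (Q ω.1) ω.2 = y ∧ ω.2 ∈ A} :=
    (measurable_winner_uncurry Q (measurableSet_singleton y)).inter (measurable_snd hA)
  rw [Measure.map_snd_prod, measure_univ, one_smul, Measure.prod_apply_symm hmeas,
    ← lintegral_indicator hA]
  refine lintegral_congr fun z => ?_
  by_cases hz : z ∈ A
  · rw [Set.indicator_of_mem hz, winnerLaw,
      ← PMF.toMeasure_apply_singleton _ _ (measurableSet_singleton y),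
      PMF.toMeasure_map_apply _ _ _ .of_discrete (measurableSet_singleton y)]
    congr 1
    ext x
    simp [hz]
  · simp [hz]

/-- **Robust Strong Functional Representation Lemma (finite family of sources).**
Given a finite family `μ_α` of pmfs on `𝒳` and a Markov kernel `Q` with
`I(μ_α, Q) < ∞` for all `α`, and `Ī = max_α I(μ_α, Q)`, there exist a probability
space carrying a random variable `Z` (here: a probability measure `PZ` on some
measurable space `𝒵`, with `Z` the second coordinate of the product space) and a
measurable `g : 𝒳 × 𝒵 → 𝒴` such that for every `α`, if `X ∼ μ_α` is independent
of `Z` (the first coordinate of the product space) and `Y = g(X, Z)`, then `(X, Y)`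
has joint pmf `μ_α(x)Q(y|x)` and `H(Y | Z) ≤ Ī + log₂(m (Ī + 1)) + 4`. -/
theorem robust_sfrl_finite
    {𝒳 𝒴 : Type} [Countable 𝒳] [Countable 𝒴]
    [MeasurableSpace 𝒳] [DiscreteMeasurableSpace 𝒳]
    [MeasurableSpace 𝒴] [DiscreteMeasurableSpace 𝒴]
    {ι : Type} [Fintype ι] [Nonempty ι]
    (μ : ι → PMF 𝒳) (Q : 𝒳 → PMF 𝒴)
    (hI : ∀ α, Summable (miSummand (μ α) Q))
    (Ibar : ℝ) (hIbar : IsGreatest (Set.range fun α => mutInfo (μ α) Q) Ibar) :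
    ∃ (𝒵 : Type) (_ : MeasurableSpace 𝒵) (PZ : Measure 𝒵) (g : 𝒳 × 𝒵 → 𝒴),
      IsProbabilityMeasure PZ ∧ Measurable g ∧
      ∀ α : ι,
        (((μ α).toMeasure.prod PZ).map fun ω => (ω.1, g ω))
            = (jointPMF (μ α) Q).toMeasure ∧
        ∃ κ : 𝒵 → PMF 𝒴,
          IsCondDistrib ((μ α).toMeasure.prod PZ) (fun ω => g ω) Prod.snd κ ∧
          ∫ z, ent2 (κ z) ∂PZ ≤
            Ibar + Real.logb 2 ((Fintype.card ι : ℝ) * (Ibar + 1)) + 4 := by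
  have hle : ∀ α, mutInfo (μ α) Q ≤ Ibar := fun α => hIbar.2 ⟨α, rfl⟩
  refine ⟨𝒴 → ℝ, inferInstance, clockLaw 𝒴, fun ω => winner (Q ω.1) ω.2, inferInstance,
    measurable_winner_uncurry Q, fun α => ⟨map_winner_eq_jointPMF (μ α) Q, winnerLaw (μ α) Q,
      isCondDistrib_winnerLaw (μ α) Q, ?_⟩⟩
  have h0 : 0 ≤ Ibar := (mutInfo_nonneg (hI α)).trans (hle α)
  have hcard : (1 : ℝ) ≤ Fintype.card ι := by exact_mod_cast Fintype.card_pos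
  have hlog : Real.logb 2 (Ibar + 1) ≤ Real.logb 2 ((Fintype.card ι : ℝ) * (Ibar + 1)) :=
    Real.logb_le_logb_of_le one_lt_two (by positivity)
      (le_mul_of_one_le_left (by positivity) hcard)
  linarith [integral_ent2_winnerLaw_le (hI α) (hle α)]
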